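/- arXiv:2202.01506 — 2 statements merged into one kernel-verified Lean document; each statement's English description precedes it below -/
import Mathlib

section
/- Let P be a compact topological space, let C ⊆ P be a closed subset, and let F, G : P → ℝ be continuous functions such that G(x) ≥ 0 for every x ∈ C, and F(x) > 0 for every x ∈ C with G(x) = 0. Then there exists a real number a > 0 such that a·G(x) + F(x) > 0 for all x ∈ C. -/
/-- On a closed subset `C` of a compact space, if `G ≥ 0` on `C` and `F > 0` at the
zeros of `G` in `C`, then some positive combination `a·G + F` is positive on `C`. -/
theorem exists_pos_combination_pos_on_closed_subset
    {P : Type*} [TopologicalSpace P] [CompactSpace P]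
    (C : Set P) (hC : IsClosed C) (F G : P → ℝ)
    (hF : Continuous F) (hG : Continuous G)
    (hGnonneg : ∀ x ∈ C, 0 ≤ G x)
    (hFpos : ∀ x ∈ C, G x = 0 → 0 < F x) :
    ∃ a : ℝ, 0 < a ∧ ∀ x ∈ C, 0 < a * G x + F x := by
  have hGpos : ∀ x ∈ C ∩ {x | F x ≤ 0}, 0 < G x := fun x hx =>
    (hGnonneg x hx.1).lt_of_ne fun h => (hFpos x hx.1 h.symm).not_ge hx.2
  have hK : IsCompact (C ∩ {x | F x ≤ 0}) :=
    (hC.inter (isClosed_le hF continuous_const)).isCompact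
  have hcont : ContinuousOn (fun x => -F x / G x) (C ∩ {x | F x ≤ 0}) :=
    hF.neg.continuousOn.div hG.continuousOn fun x hx => (hGpos x hx).ne'
  obtain ⟨B, hB⟩ := hK.bddAbove_image hcont
  have ha : 0 < max B 0 + 1 := by positivity
  refine ⟨max B 0 + 1, ha, fun x hx => ?_⟩
  rcases lt_or_ge 0 (F x) with h | h
  · have := mul_nonneg ha.le (hGnonneg x hx)
    linarith
  · have hlt : -F x / G x < max B 0 + 1 :=
      (hB (Set.mem_image_of_mem _ ⟨hx, h⟩)).trans_lt (by linarith [le_max_left B 0])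
    rw [div_lt_iff₀ (hGpos x ⟨hx, h⟩)] at hlt
    linarith
end

section
/- Let Z₂ : ℝ × ℂ → ℂ be a smooth (C^∞) map with Z₂(t,0) = 0 for all t ∈ ℝ. Define b : ℝ × ℝ → ℝ by b(t,θ) = Re( conj(i·e^{iθ}) · (D₂Z₂(t,0))(e^{iθ}) ), where D₂Z₂(t,0) is the Fréchet derivative over ℝ at 0 of the map z ↦ Z₂(t,z). Then the function W : ℝ³ → ℝ defined by W(t,r,θ) = r⁻¹ · Re( conj(i·e^{iθ}) · Z₂(t, r·e^{iθ}) ) for r ≠ 0 and W(t,0,θ) = b(t,θ) is smooth (C^∞) on all of ℝ³. -/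
open Complex

universe u

/-- Differentiation under an integral over a compact interval, for a jointly `C¹` integrand. -/
theorem hasFDerivAt_intervalIntegral_of_contDiff_one
    {H E : Type*} [NormedAddCommGroup H] [NormedSpace ℝ H] [ProperSpace H]
    [NormedAddCommGroup E] [NormedSpace ℝ E] {F : H × ℝ → E} (hF : ContDiff ℝ 1 F)
    (a b : ℝ) (x₀ : H) :
    HasFDerivAt (fun x => ∫ s in a..b, F (x, s))
      (∫ s in a..b, (fderiv ℝ F (x₀, s)).comp (ContinuousLinearMap.inl ℝ H ℝ)) x₀ := by
  have hF' : Continuous fun p : H × ℝ =>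
      (fderiv ℝ F p).comp (ContinuousLinearMap.inl ℝ H ℝ) :=
    (hF.continuous_fderiv one_ne_zero).clm_comp continuous_const
  obtain ⟨C, hC⟩ := ((isCompact_closedBall x₀ 1).prod
    (isCompact_uIcc (a := a) (b := b))).exists_bound_of_continuousOn hF'.continuousOn
  refine intervalIntegral.hasFDerivAt_integral_of_dominated_of_fderiv_le
    (F := fun x s => F (x, s))
    (F' := fun x s => (fderiv ℝ F (x, s)).comp (ContinuousLinearMap.inl ℝ H ℝ))
    (bound := fun _ => C) (Metric.closedBall_mem_nhds x₀ one_pos) ?_ ?_ ?_ ?_ ?_ ?_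
  · exact Filter.Eventually.of_forall fun x =>
      (hF.continuous.comp (Continuous.prodMk_right x)).aestronglyMeasurable
  · exact (hF.continuous.comp (Continuous.prodMk_right x₀)).intervalIntegrable a b
  · exact (hF'.comp (Continuous.prodMk_right x₀)).aestronglyMeasurable
  · exact Filter.Eventually.of_forall fun s hs x hx =>
      hC (x, s) ⟨hx, Set.uIoc_subset_uIcc hs⟩
  · exact intervalIntegrable_const
  · exact Filter.Eventually.of_forall fun s _ x _ =>
      ((hF.differentiable one_ne_zero).differentiableAt.hasFDerivAt).comp x
        (hasFDerivAt_prodMk_left x s)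

theorem contDiff_nat_intervalIntegral
    {H : Type u} [NormedAddCommGroup H] [NormedSpace ℝ H] [ProperSpace H] (a b : ℝ) (n : ℕ) :
    ∀ {E : Type u} [NormedAddCommGroup E] [NormedSpace ℝ E] {F : H × ℝ → E},
      ContDiff ℝ n F → ContDiff ℝ n fun x => ∫ s in a..b, F (x, s) := by
  induction n with
  | zero =>
    intro E _ _ F hF
    exact contDiff_zero.2 <|
      intervalIntegral.continuous_parametric_intervalIntegral_of_continuous'
        (f := fun x s => F (x, s)) hF.continuous a b
  | succ n ih =>
    intro E _ _ F hF
    refine contDiff_succ_iff_hasFDerivAt.2 ⟨_, ?_, fun x =>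
      hasFDerivAt_intervalIntegral_of_contDiff_one (hF.of_le (by simp)) a b x⟩
    exact ih (F := fun p => (fderiv ℝ F p).comp (ContinuousLinearMap.inl ℝ H ℝ))
      ((hF.fderiv_right (m := n) (by simp)).clm_comp contDiff_const)

/-- The integral over a compact interval of a jointly smooth function depends smoothly on the
parameter. -/
theorem contDiff_infty_intervalIntegral
    {H E : Type u} [NormedAddCommGroup H] [NormedSpace ℝ H] [ProperSpace H]
    [NormedAddCommGroup E] [NormedSpace ℝ E] {F : H × ℝ → E}
    (hF : ContDiff ℝ (⊤ : ℕ∞) F) (a b : ℝ) :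
    ContDiff ℝ (⊤ : ℕ∞) fun x => ∫ s in a..b, F (x, s) :=
  contDiff_infty.2 fun n => contDiff_nat_intervalIntegral a b n (contDiff_infty.1 hF n)

/-- Hadamard's lemma along a ray. -/
theorem smul_integral_fderiv_eq_sub
    {E F : Type*} [NormedAddCommGroup E] [NormedSpace ℝ E]
    [NormedAddCommGroup F] [NormedSpace ℝ F] [CompleteSpace F] {f : E → F}
    (hf : ContDiff ℝ 1 f) (x v : E) (r : ℝ) :
    r • ∫ s in (0 : ℝ)..1, fderiv ℝ f (x + (s * r) • v) v = f (x + r • v) - f x := by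
  have hderiv (s : ℝ) : HasDerivAt (fun s : ℝ => f (x + (s * r) • v))
      (r • fderiv ℝ f (x + (s * r) • v) v) s := by
    have h : HasDerivAt (fun s : ℝ => x + (s * r) • v) (r • v) s := by
      simpa using (((hasDerivAt_id s).mul_const r).smul_const v).const_add x
    simpa [Function.comp_def] using
      (hf.differentiable one_ne_zero).differentiableAt.hasFDerivAt.comp_hasDerivAt s h
  have hcont : Continuous fun s : ℝ => r • fderiv ℝ f (x + (s * r) • v) v :=
    (((hf.continuous_fderiv one_ne_zero).comp (by fun_prop)).clm_apply
      continuous_const).const_smul r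
  rw [← intervalIntegral.integral_smul, intervalIntegral.integral_eq_sub_of_hasDerivAt
    (fun s _ => hderiv s) (hcont.intervalIntegrable 0 1)]
  simp

/-- The angular component of the blow-up of a smooth vector field `Z₂` vanishing along
`ℝ × {0}` extends smoothly across `r = 0`, with value `b(t,θ)` given by the linearized
dynamics. -/
theorem angular_component_extends_smoothly_across_zero
    (Z₂ : ℝ × ℂ → ℂ) (hZ : ContDiff ℝ (⊤ : ℕ∞) Z₂) (h0 : ∀ t : ℝ, Z₂ (t, 0) = 0)
    (b : ℝ → ℝ → ℝ)
    (hb : ∀ t θ : ℝ, b t θ =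
      ((starRingEnd ℂ) (Complex.I * Complex.exp (θ * Complex.I)) *
        (fderiv ℝ (fun z => Z₂ (t, z)) 0) (Complex.exp (θ * Complex.I))).re)
    (W : ℝ × ℝ × ℝ → ℝ)
    (hW : ∀ t r θ : ℝ, r ≠ 0 → W (t, r, θ) =
      r⁻¹ * ((starRingEnd ℂ) (Complex.I * Complex.exp (θ * Complex.I)) *
        Z₂ (t, (r : ℂ) * Complex.exp (θ * Complex.I))).re)
    (hW0 : ∀ t θ : ℝ, W (t, 0, θ) = b t θ) :
    ContDiff ℝ (⊤ : ℕ∞) W := by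
  have hexp : ContDiff ℝ (⊤ : ℕ∞) fun p : ℝ × ℝ × ℝ => Complex.exp (p.2.2 * Complex.I) :=
    Complex.contDiff_exp.comp
      ((Complex.ofRealCLM.contDiff.comp (contDiff_snd.comp contDiff_snd)).mul contDiff_const)
  have hG : ContDiff ℝ (⊤ : ℕ∞) fun q : (ℝ × ℝ × ℝ) × ℝ =>
      fderiv ℝ Z₂ (((q.1.1, 0) : ℝ × ℂ) +
        (q.2 * q.1.2.1) • ((0, Complex.exp (q.1.2.2 * Complex.I)) : ℝ × ℂ))
        (0, Complex.exp (q.1.2.2 * Complex.I)) := by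
    have he := hexp.comp (contDiff_fst (𝕜 := ℝ) (E := ℝ × ℝ × ℝ) (F := ℝ))
    have hv : ContDiff ℝ (⊤ : ℕ∞) fun q : (ℝ × ℝ × ℝ) × ℝ =>
        ((0, Complex.exp (q.1.2.2 * Complex.I)) : ℝ × ℂ) := contDiff_const.prodMk he
    have hx : ContDiff ℝ (⊤ : ℕ∞) fun q : (ℝ × ℝ × ℝ) × ℝ =>
        ((q.1.1, 0) : ℝ × ℂ) := by fun_prop
    have hr : ContDiff ℝ (⊤ : ℕ∞) fun q : (ℝ × ℝ × ℝ) × ℝ => q.2 * q.1.2.1 := by fun_prop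
    exact ((hZ.fderiv_right (m := (⊤ : ℕ∞)) (by simp)).comp (hx.add (hr.smul hv))).clm_apply hv
  have hW_eq : W = fun p : ℝ × ℝ × ℝ =>
      ((starRingEnd ℂ) (Complex.I * Complex.exp (p.2.2 * Complex.I)) *
        ∫ s in (0 : ℝ)..1, fderiv ℝ Z₂ (((p.1, 0) : ℝ × ℂ) +
          (s * p.2.1) • ((0, Complex.exp (p.2.2 * Complex.I)) : ℝ × ℂ))
          (0, Complex.exp (p.2.2 * Complex.I))).re := by
    funext ⟨t, r, θ⟩
    rcases eq_or_ne r 0 with rfl | hr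
    · have hpartial : HasFDerivAt (fun z => Z₂ (t, z))
          ((fderiv ℝ Z₂ (t, 0)).comp (ContinuousLinearMap.inr ℝ ℝ ℂ)) 0 :=
        ((hZ.differentiable (by simp)).differentiableAt.hasFDerivAt).comp 0
          (hasFDerivAt_prodMk_right t 0)
      rw [hW0, hb, hpartial.fderiv]
      simp
    · have h := smul_integral_fderiv_eq_sub (hZ.of_le (by simp)) ((t, 0) : ℝ × ℂ)
        (0, Complex.exp (θ * Complex.I)) r
      simp only [h0, sub_zero, Prod.smul_mk, Prod.mk_add_mk, smul_zero, add_zero, zero_add,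
        Complex.real_smul] at h
      rw [hW t r θ hr, ← h, mul_left_comm, Complex.re_ofReal_mul, inv_mul_cancel_left₀ hr]
      simp
  rw [hW_eq]
  exact Complex.reCLM.contDiff.comp
    ((Complex.conjCLE.contDiff.comp (contDiff_const.mul hexp)).mul
      (contDiff_infty_intervalIntegral hG 0 1))
end
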